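/- arXiv:2305.18379 — 5 statements merged into one kernel-verified Lean document; each statement's English description precedes it below -/
import Mathlib

section
/- Suppose z̃ = (x̃, λ̃) ∈ ℝⁿ × ℝᵐ satisfies ‖z̃ − (Δx, Δλ)‖ ≤ δ‖(Δx, Δλ)‖ for some δ ≥ 0. If the penalty parameters satisfy η₂ ≤ ξ_B/(12Υ²), η₁·η₂ ≥ 5Υ²/ξ_G², and δ·η₁/η₂ ≤ ξ_G/(16Υ²), then Dᵀz̃ ≤ −(η₂/2)·(‖g‖² + ‖c‖²). (Deterministic core of Lemma 4.3 / 'Lemma 11': an inexact Newton direction satisfying the accuracy condition is a descent direction of the exact augmented Lagrangian.) -/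
open scoped RealInnerProductSpace

open ContinuousLinearMap (adjoint)

section Surjective

variable {E F : Type*} [NormedAddCommGroup E] [InnerProductSpace ℝ E] [CompleteSpace E]
  [NormedAddCommGroup F] [InnerProductSpace ℝ F] [CompleteSpace F]

/-- If `s² ≤ G G†`, then `G†` is bounded below by `s`. -/
theorem mul_norm_le_norm_adjoint {G : E →L[ℝ] F} {s : ℝ}
    (hG : ∀ w, s ^ 2 * ‖w‖ ^ 2 ≤ ⟪w, G (adjoint G w)⟫) (w : F) :
    s * ‖w‖ ≤ ‖adjoint G w‖ := by
  have h := hG w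
  rw [← ContinuousLinearMap.adjoint_inner_left, real_inner_self_eq_norm_sq, ← mul_pow] at h
  exact le_of_sq_le_sq h (norm_nonneg _)

/-- If `s² ≤ G G†` with `s > 0`, every vector splits as `u + v` with `u ∈ ker G` and
`s ‖v‖ ≤ ‖G (u + v)‖`. -/
theorem exists_ker_add_of_le_mul_adjoint [FiniteDimensional ℝ F] {G : E →L[ℝ] F} {s : ℝ}
    (hs : 0 < s) (hG : ∀ w, s ^ 2 * ‖w‖ ^ 2 ≤ ⟪w, G (adjoint G w)⟫) (d : E) :
    ∃ u v, d = u + v ∧ G u = 0 ∧ s * ‖v‖ ≤ ‖G d‖ := by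
  have hinj : Function.Injective (G ∘L adjoint G : F →L[ℝ] F).toLinearMap := by
    rw [← LinearMap.ker_eq_bot, LinearMap.ker_eq_bot']
    intro w hw
    have hw0 : G (adjoint G w) = 0 := hw
    have h := hG w
    rw [hw0, inner_zero_right] at h
    have : ‖w‖ ^ 2 ≤ 0 := by
      by_contra! hpos
      exact absurd h (not_le.mpr (by positivity))
    exact norm_eq_zero.mp (pow_eq_zero_iff two_ne_zero |>.mp (le_antisymm this (by positivity)))
  obtain ⟨w, hw⟩ := LinearMap.injective_iff_surjective.mp hinj (G d)
  replace hw : G (adjoint G w) = G d := hw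
  refine ⟨d - adjoint G w, adjoint G w, by abel, by rw [map_sub, hw, sub_self], ?_⟩
  have hsw := mul_norm_le_norm_adjoint hG w
  have hv : ‖adjoint G w‖ ^ 2 ≤ ‖w‖ * ‖G d‖ := by
    rw [← real_inner_self_eq_norm_sq, ContinuousLinearMap.adjoint_inner_left, hw]
    exact real_inner_le_norm _ _
  rcases (norm_nonneg (adjoint G w)).eq_or_lt with h0 | h0
  · rw [← h0, mul_zero]
    exact norm_nonneg _
  · refine le_of_mul_le_mul_right ?_ h0
    calc s * ‖adjoint G w‖ * ‖adjoint G w‖ = s * ‖adjoint G w‖ ^ 2 := by ring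
      _ ≤ s * (‖w‖ * ‖G d‖) := by gcongr
      _ = s * ‖w‖ * ‖G d‖ := by ring
      _ ≤ ‖adjoint G w‖ * ‖G d‖ := by gcongr
      _ = ‖G d‖ * ‖adjoint G w‖ := mul_comm _ _

/-- The directional derivative of the exact augmented Lagrangian along the Newton direction. -/
theorem inner_gradient_newton_eq {H B : E →L[ℝ] E} {G : E →L[ℝ] F} (hH : IsSelfAdjoint H)
    {g d : E} {c l : F} (h₁ : B d + adjoint G l = -g) (h₂ : G d = -c) (η₁ η₂ : ℝ) :
    ⟪g + η₂ • H g + η₁ • adjoint G c, d⟫ + ⟪c + η₂ • G g, l⟫ =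
      -⟪d, B d⟫ + 2 * ⟪c, l⟫ - η₁ * ‖c‖ ^ 2 - η₂ * ‖g‖ ^ 2 + η₂ * ⟪g, H d - B d⟫ := by
  have hl : adjoint G l = -g - B d := by rw [← h₁]; abel
  have hHg : ⟪H g, d⟫ = ⟪g, H d⟫ := by
    rw [← ContinuousLinearMap.adjoint_inner_right, hH.adjoint_eq]
  have hGg : ⟪G g, l⟫ = -‖g‖ ^ 2 - ⟪g, B d⟫ := by
    rw [← ContinuousLinearMap.adjoint_inner_right, hl, inner_sub_right, inner_neg_right,
      real_inner_self_eq_norm_sq]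
  have hGc : ⟪adjoint G c, d⟫ = -‖c‖ ^ 2 := by
    rw [ContinuousLinearMap.adjoint_inner_left, h₂, inner_neg_right, real_inner_self_eq_norm_sq]
  have hg : ⟪g, d⟫ = -⟪d, B d⟫ + ⟪c, l⟫ := by
    have hg' : g = -B d - adjoint G l := by rw [hl]; abel
    rw [hg', inner_sub_left, inner_neg_left, ContinuousLinearMap.adjoint_inner_left, h₂,
      inner_neg_right, real_inner_comm d, real_inner_comm l]
    ring
  simp only [inner_add_left, real_inner_smul_left, inner_sub_right, hHg, hGg, hGc, hg]
  ring

/-- Lower bound for a quadratic form on a sum, from coercivity on the first summand. -/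
theorem le_inner_add_apply_add {B : E →L[ℝ] E} (hB : IsSelfAdjoint B) {Υ ξ : ℝ}
    (hBn : ‖B‖ ≤ Υ) {u v : E} (hu : ξ * ‖u‖ ^ 2 ≤ ⟪u, B u⟫) :
    ξ * ‖u‖ ^ 2 - 2 * Υ * ‖u‖ * ‖v‖ - Υ * ‖v‖ ^ 2 ≤ ⟪u + v, B (u + v)⟫ := by
  have hvu : ⟪v, B u⟫ = ⟪u, B v⟫ := by
    rw [real_inner_comm, ← ContinuousLinearMap.adjoint_inner_right, hB.adjoint_eq]
  have hbound (x : E) : -(‖x‖ * (Υ * ‖v‖)) ≤ ⟪x, B v⟫ := by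
    have h := (abs_le.mp (abs_real_inner_le_norm x (B v))).1
    have : ‖x‖ * ‖B v‖ ≤ ‖x‖ * (Υ * ‖v‖) := by
      gcongr
      exact B.le_of_opNorm_le hBn v
    linarith
  rw [map_add, inner_add_left, inner_add_right, inner_add_right, hvu]
  linarith [hbound u, hbound v]

end Surjective

/-- Cauchy–Schwarz on a product, with the sum of norms bounding the product norm. -/
theorem inner_add_inner_le_mul {E F : Type*} [NormedAddCommGroup E] [InnerProductSpace ℝ E]
    [NormedAddCommGroup F] [InnerProductSpace ℝ F] {δ : ℝ} (hδ : 0 ≤ δ) (p e d : E) (q f l : F)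
    (h : √(‖e‖ ^ 2 + ‖f‖ ^ 2) ≤ δ * √(‖d‖ ^ 2 + ‖l‖ ^ 2)) :
    ⟪p, e⟫ + ⟪q, f⟫ ≤ δ * ((‖p‖ + ‖q‖) * (‖d‖ + ‖l‖)) := by
  have hS : √(‖d‖ ^ 2 + ‖l‖ ^ 2) ≤ ‖d‖ + ‖l‖ := by
    rw [Real.sqrt_le_left (by positivity)]
    nlinarith [mul_nonneg (norm_nonneg d) (norm_nonneg l)]
  have hδS := h.trans (mul_le_mul_of_nonneg_left hS hδ)
  have he : ‖e‖ ≤ δ * (‖d‖ + ‖l‖) :=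
    (Real.le_sqrt_of_sq_le (by linarith [sq_nonneg ‖f‖])).trans hδS
  have hf : ‖f‖ ≤ δ * (‖d‖ + ‖l‖) :=
    (Real.le_sqrt_of_sq_le (by linarith [sq_nonneg ‖e‖])).trans hδS
  calc ⟪p, e⟫ + ⟪q, f⟫ ≤ ‖p‖ * ‖e‖ + ‖q‖ * ‖f‖ :=
        add_le_add (real_inner_le_norm _ _) (real_inner_le_norm _ _)
    _ ≤ ‖p‖ * (δ * (‖d‖ + ‖l‖)) + ‖q‖ * (δ * (‖d‖ + ‖l‖)) := by gcongr
    _ = δ * ((‖p‖ + ‖q‖) * (‖d‖ + ‖l‖)) := by ring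

/-- The quadratic form that controls the descent after rescaling by `η₂`. -/
theorem descent_quadratic_form_nonpos {x y k t : ℝ} (hy : 0 ≤ y) (hk : 0 ≤ k)
    (ht : t ≤ 1 / 24) :
    -12 * x ^ 2 + 4 * x * y + 3 * t * y ^ 2 + 2 * y * k + 2 * k * x + 2 * t * k * y - k ^ 2
      - 20 * y ^ 2 + 1 / 16 * (k / 960 + y / 48) * (k + 2 * x + 2 * t * y)
      + (k ^ 2 + (y / 48) ^ 2) / 2 ≤ 0 := by
  have h₁ : t * y ^ 2 ≤ 1 / 24 * y ^ 2 := by gcongr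
  have h₂ : t * (k * y) ≤ 1 / 24 * (k * y) := by gcongr
  nlinarith [sq_nonneg (4 * x - k), sq_nonneg (8 * y - k), sq_nonneg (x - y),
    mul_nonneg hy hk, sq_nonneg x, sq_nonneg y, sq_nonneg k]

/-- Numerical bounds on the penalty parameters implied by the parameter conditions. -/
theorem penalty_bounds {s ξB Υ η₁ η₂ : ℝ} (hs : 0 < s) (hs1 : s ≤ 1) (hξB1 : ξB ≤ 1)
    (hΥ : 2 ≤ Υ) (hη₁ : 0 < η₁) (hη₂ : 0 < η₂) (h₂ : 12 * Υ ^ 2 * η₂ ≤ ξB)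
    (h₁₂ : 5 * Υ ^ 2 ≤ η₁ * η₂ * s ^ 4) :
    η₂ ≤ 1 / 48 ∧ Υ * η₂ ≤ 1 / 24 ∧ 20 ≤ η₁ * η₂ * s ^ 2 ∧ 960 ≤ η₁ := by
  have hΥη₂ : 2 * (Υ * η₂) ≤ Υ * (Υ * η₂) := by gcongr
  have hη₂Υ : 2 * η₂ ≤ Υ * η₂ := by gcongr
  have ht : Υ * η₂ ≤ 1 / 24 := by linarith
  have hη₂s : η₂ ≤ 1 / 48 := by linarith
  have hs4 : s ^ 4 ≤ s ^ 2 := pow_le_pow_of_le_one hs.le hs1 (by norm_num)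
  have hηη : 5 * Υ ^ 2 ≤ η₁ * η₂ * s ^ 2 := h₁₂.trans (by gcongr)
  have hΥ2 : 2 ^ 2 ≤ Υ ^ 2 := by gcongr
  have hle : η₁ * η₂ * s ^ 2 ≤ η₁ * (1 / 48) * 1 := by
    gcongr
    exact pow_le_one₀ hs.le hs1
  exact ⟨hη₂s, ht, by linarith, by linarith⟩

/-- The scalar estimate behind the descent property: `a, C, k, r` stand for the norms of the
kernel part of the step, the rescaled constraint, the gradient and the multiplier step. -/
theorem descent_scalar_bound {a C k r s ξB Υ η₁ η₂ δ : ℝ} (ha : 0 ≤ a) (hC : 0 ≤ C)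
    (hk : 0 ≤ k) (hs : 0 < s) (hs1 : s ≤ 1) (hξB1 : ξB ≤ 1) (hΥ : 2 ≤ Υ)
    (hη₁ : 0 < η₁) (hη₂ : 0 < η₂) (hδ : 0 ≤ δ)
    (hr : s * r ≤ k + Υ * (a + C))
    (h₂ : 12 * Υ ^ 2 * η₂ ≤ ξB) (h₁₂ : 5 * Υ ^ 2 ≤ η₁ * η₂ * s ^ 4)
    (hδη : 16 * Υ ^ 2 * (δ * η₁) ≤ s ^ 2 * η₂) :
    -(ξB * a ^ 2 - 2 * Υ * a * C - Υ * C ^ 2) + 2 * (s * C * r) - η₁ * (s * C) ^ 2 - η₂ * k ^ 2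
      + η₂ * (k * (2 * Υ * (a + C)))
      + δ * ((2 * k + 2 * η₁ * Υ * (s * C)) * (a + C + r))
      ≤ -(η₂ / 2) * (k ^ 2 + (s * C) ^ 2) := by
  obtain ⟨hη₂s, ht, h20, hη₁_large⟩ := penalty_bounds hs hs1 hξB1 hΥ hη₁ hη₂ h₂ h₁₂
  have hs2 : s ^ 2 ≤ 1 := pow_le_one₀ hs.le hs1
  obtain ⟨y, rfl⟩ : ∃ y, C = η₂ * y := ⟨C / η₂, by field_simp⟩
  have hy : 0 ≤ y := nonneg_of_mul_nonneg_right hC hη₂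
  have hcurv : η₂ * (12 * (Υ * a) ^ 2) ≤ ξB * a ^ 2 := by
    have := mul_le_mul_of_nonneg_right h₂ (sq_nonneg a)
    linarith
  have hpen : η₂ * (20 * y ^ 2) ≤ η₁ * (s * (η₂ * y)) ^ 2 := by
    have := mul_le_mul_of_nonneg_right h20 (by positivity : 0 ≤ η₂ * y ^ 2)
    linarith
  have hcross : s * (η₂ * y) * r ≤ η₂ * (y * (k + Υ * (a + η₂ * y))) := by
    have := mul_le_mul_of_nonneg_left hr hC
    linarith
  have hc : (s * (η₂ * y)) ^ 2 ≤ (y / 48) ^ 2 := by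
    have : s * (η₂ * y) ≤ 1 * (1 / 48 * y) := by gcongr
    gcongr
    linarith
  have herr : δ * ((2 * k + 2 * η₁ * Υ * (s * (η₂ * y))) * (a + η₂ * y + r)) ≤
      η₂ * (1 / 16 * (k / 960 + y / 48) * (k + 2 * (Υ * a) + 2 * (Υ * η₂) * y)) := by
    have hZ : s * (a + η₂ * y + r) ≤ k + 2 * (Υ * a) + 2 * (Υ * η₂) * y := by
      have : s * (a + η₂ * y) ≤ Υ * (a + η₂ * y) :=
        mul_le_mul_of_nonneg_right (by linarith) (by positivity)
      linarith
    have hZ0 : 0 ≤ k + 2 * (Υ * a) + 2 * (Υ * η₂) * y := by positivity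
    have hδη₁ : δ * η₁ * Υ * 32 ≤ s ^ 2 * η₂ := by
      have : δ * η₁ * Υ * 2 ≤ δ * η₁ * Υ * Υ := by gcongr
      linarith
    have hδs : 64 * 960 * δ ≤ s * η₂ := by
      have h₄ : δ * 960 * 2 ≤ δ * η₁ * Υ := by gcongr
      have h₅ : s ^ 2 * η₂ ≤ s * η₂ := by gcongr; nlinarith
      linarith
    have hW : δ * (2 * k + 2 * η₁ * Υ * (s * (η₂ * y))) ≤
        s * (η₂ * (1 / 16 * (k / 960 + y / 48))) := by
      have h₆ := mul_le_mul_of_nonneg_right hδs hk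
      have h₇ := mul_le_mul_of_nonneg_right hδη₁ (by positivity : 0 ≤ s * (η₂ * y))
      have h₈ : s ^ 2 * η₂ * (s * (η₂ * y)) ≤ 1 * η₂ * (s * (1 / 48 * y)) := by gcongr
      have h₉ : 0 ≤ s * η₂ * k := by positivity
      linarith
    calc δ * ((2 * k + 2 * η₁ * Υ * (s * (η₂ * y))) * (a + η₂ * y + r))
        = δ * (2 * k + 2 * η₁ * Υ * (s * (η₂ * y))) * (s * (a + η₂ * y + r)) / s := by
          field_simp
      _ ≤ δ * (2 * k + 2 * η₁ * Υ * (s * (η₂ * y)))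
            * (k + 2 * (Υ * a) + 2 * (Υ * η₂) * y) / s := by gcongr
      _ ≤ s * (η₂ * (1 / 16 * (k / 960 + y / 48)))
            * (k + 2 * (Υ * a) + 2 * (Υ * η₂) * y) / s := by gcongr
      _ = η₂ * (1 / 16 * (k / 960 + y / 48) * (k + 2 * (Υ * a) + 2 * (Υ * η₂) * y)) := by
          field_simp
  have hform := mul_nonpos_of_nonneg_of_nonpos hη₂.le
    (descent_quadratic_form_nonpos (x := Υ * a) hy hk ht)
  have hc' := mul_le_mul_of_nonneg_left hc hη₂.le
  linarith

/-- deterministic core of Lemma 11.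
An inexact Newton direction `(xt, lt)` satisfying the accuracy condition
`‖z̃ − Δz‖ ≤ δ‖Δz‖` is a descent direction of the exact augmented Lagrangian,
provided `η₂ ≤ ξ_B/(12Υ²)`, `η₁η₂ ≥ 5Υ²/ξ_G²` and `δη₁/η₂ ≤ ξ_G/(16Υ²)`. -/
theorem stmt_0 (n m : ℕ)
    (H B : EuclideanSpace ℝ (Fin n) →L[ℝ] EuclideanSpace ℝ (Fin n))
    (G : EuclideanSpace ℝ (Fin n) →L[ℝ] EuclideanSpace ℝ (Fin m))
    (hH : IsSelfAdjoint H) (hB : IsSelfAdjoint B)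
    (ξG ξB Υ : ℝ) (hξG0 : 0 < ξG) (hξG1 : ξG ≤ 1) (hξB0 : 0 < ξB) (hξB1 : ξB ≤ 1)
    (hΥ : 2 ≤ Υ)
    (hGGT : ∀ w : EuclideanSpace ℝ (Fin m),
      ξG * ‖w‖ ^ 2 ≤ ⟪w, G (ContinuousLinearMap.adjoint G w)⟫)
    (hBcoer : ∀ u : EuclideanSpace ℝ (Fin n), G u = 0 → ξB * ‖u‖ ^ 2 ≤ ⟪u, B u⟫)
    (hnorms : max (max ‖H‖ ‖G‖) ‖B‖ ≤ Υ)
    (g : EuclideanSpace ℝ (Fin n)) (c : EuclideanSpace ℝ (Fin m))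
    (Δx : EuclideanSpace ℝ (Fin n)) (Δl : EuclideanSpace ℝ (Fin m))
    (hNewton1 : B Δx + ContinuousLinearMap.adjoint G Δl = -g)
    (hNewton2 : G Δx = -c)
    (η₁ η₂ : ℝ) (hη₁ : 0 < η₁) (hη₂ : 0 < η₂)
    (Dx : EuclideanSpace ℝ (Fin n)) (Dl : EuclideanSpace ℝ (Fin m))
    (hDx : Dx = g + η₂ • H g + η₁ • ContinuousLinearMap.adjoint G c)
    (hDl : Dl = c + η₂ • G g)
    (xt : EuclideanSpace ℝ (Fin n)) (lt : EuclideanSpace ℝ (Fin m))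
    (δ : ℝ) (hδ0 : 0 ≤ δ)
    (hacc : Real.sqrt (‖xt - Δx‖ ^ 2 + ‖lt - Δl‖ ^ 2)
      ≤ δ * Real.sqrt (‖Δx‖ ^ 2 + ‖Δl‖ ^ 2))
    (hη₂le : η₂ ≤ ξB / (12 * Υ ^ 2))
    (hη₁η₂ : 5 * Υ ^ 2 / ξG ^ 2 ≤ η₁ * η₂)
    (hδη : δ * η₁ / η₂ ≤ ξG / (16 * Υ ^ 2)) :
    ⟪Dx, xt⟫ + ⟪Dl, lt⟫ ≤ -(η₂ / 2) * (‖g‖ ^ 2 + ‖c‖ ^ 2) := by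
  obtain ⟨s, hs, rfl⟩ : ∃ s, 0 < s ∧ ξG = s ^ 2 :=
    ⟨√ξG, Real.sqrt_pos.mpr hξG0, (Real.sq_sqrt hξG0.le).symm⟩
  have hs1 : s ≤ 1 := by nlinarith
  have hHn : ‖H‖ ≤ Υ := (le_max_left _ _).trans ((le_max_left _ _).trans hnorms)
  have hGn : ‖G‖ ≤ Υ := (le_max_right _ _).trans ((le_max_left _ _).trans hnorms)
  have hBn : ‖B‖ ≤ Υ := (le_max_right _ _).trans hnorms
  have hΥ0 : 0 < Υ := by linarith
  have h₂ : 12 * Υ ^ 2 * η₂ ≤ ξB := by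
    rwa [le_div_iff₀ (by positivity), mul_comm] at hη₂le
  have h₁₂ : 5 * Υ ^ 2 ≤ η₁ * η₂ * s ^ 4 := by
    rw [div_le_iff₀ (by positivity)] at hη₁η₂
    linarith
  have hδη' : 16 * Υ ^ 2 * (δ * η₁) ≤ s ^ 2 * η₂ := by
    rw [div_le_div_iff₀ hη₂ (by positivity)] at hδη
    linarith
  obtain ⟨u, v, hd, hGu, hv⟩ := exists_ker_add_of_le_mul_adjoint hs hGGT Δx
  rw [hNewton2, norm_neg] at hv
  obtain ⟨C, hcC⟩ : ∃ C, ‖c‖ = s * C := ⟨‖c‖ / s, by field_simp⟩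
  have hC : 0 ≤ C := nonneg_of_mul_nonneg_right (hcC ▸ norm_nonneg c) hs
  have hvC : ‖v‖ ≤ C := le_of_mul_le_mul_left (hcC ▸ hv) hs
  have hdn : ‖Δx‖ ≤ ‖u‖ + C := by
    rw [hd]
    exact (norm_add_le _ _).trans (by gcongr)
  have hBd : ‖B Δx‖ ≤ Υ * (‖u‖ + C) :=
    (B.le_of_opNorm_le hBn Δx).trans (by gcongr)
  have hHd : ‖H Δx‖ ≤ Υ * (‖u‖ + C) :=
    (H.le_of_opNorm_le hHn Δx).trans (by gcongr)
  have hr : s * ‖Δl‖ ≤ ‖g‖ + Υ * (‖u‖ + C) := by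
    refine (mul_norm_le_norm_adjoint hGGT Δl).trans ?_
    have : ContinuousLinearMap.adjoint G Δl = -g - B Δx := by rw [← hNewton1]; abel
    rw [this]
    refine (norm_sub_le _ _).trans ?_
    rw [norm_neg]
    gcongr
  have hcurv : ξB * ‖u‖ ^ 2 - 2 * Υ * ‖u‖ * C - Υ * C ^ 2 ≤ ⟪Δx, B Δx⟫ := by
    refine le_trans ?_ (hd ▸ le_inner_add_apply_add hB hBn (v := v) (hBcoer u hGu))
    gcongr
  have hcl : ⟪c, Δl⟫ ≤ s * C * ‖Δl‖ := hcC ▸ real_inner_le_norm c Δl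
  have hgHB : ⟪g, H Δx - B Δx⟫ ≤ ‖g‖ * (2 * Υ * (‖u‖ + C)) := by
    refine (real_inner_le_norm _ _).trans ?_
    gcongr
    exact (norm_sub_le _ _).trans (by linarith)
  obtain ⟨-, hΥη₂, -, hη₁_large⟩ := penalty_bounds hs hs1 hξB1 hΥ hη₁ hη₂ h₂ h₁₂
  have hη₁1 : 1 ≤ η₁ * Υ := one_le_mul_of_one_le_of_one_le (by linarith) (by linarith)
  have hDn : ‖Dx‖ + ‖Dl‖ ≤ 2 * ‖g‖ + 2 * η₁ * Υ * (s * C) := by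
    have hx : ‖Dx‖ ≤ ‖g‖ + η₂ * (Υ * ‖g‖) + η₁ * (Υ * ‖c‖) := by
      rw [hDx]
      refine (norm_add₃_le).trans ?_
      rw [norm_smul_of_nonneg hη₂.le, norm_smul_of_nonneg hη₁.le]
      gcongr
      · exact H.le_of_opNorm_le hHn g
      · exact ContinuousLinearMap.le_of_opNorm_le _ (by simpa using hGn) c
    have hl : ‖Dl‖ ≤ ‖c‖ + η₂ * (Υ * ‖g‖) := by
      rw [hDl]
      refine (norm_add_le _ _).trans ?_
      rw [norm_smul_of_nonneg hη₂.le]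
      gcongr
      exact G.le_of_opNorm_le hGn g
    have h₃ := mul_le_mul_of_nonneg_right hΥη₂ (norm_nonneg g)
    have h₄ := mul_le_mul_of_nonneg_right hη₁1 (norm_nonneg c)
    rw [← hcC]
    linarith [norm_nonneg g]
  have herr : ⟪Dx, xt - Δx⟫ + ⟪Dl, lt - Δl⟫ ≤
      δ * ((2 * ‖g‖ + 2 * η₁ * Υ * (s * C)) * (‖u‖ + C + ‖Δl‖)) := by
    refine (inner_add_inner_le_mul hδ0 _ _ _ _ _ _ hacc).trans ?_
    gcongr
  have hexact := inner_gradient_newton_eq hH hNewton1 hNewton2 η₁ η₂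
  rw [← hDx, ← hDl, hcC] at hexact
  have hmain := descent_scalar_bound (norm_nonneg u) hC (norm_nonneg g) hs hs1 hξB1 hΥ hη₁ hη₂
    hδ0 hr h₂ h₁₂ hδη'
  have hgHB' := mul_le_mul_of_nonneg_left hgHB hη₂.le
  rw [inner_sub_right, inner_sub_right] at herr
  rw [hcC]
  linarith
end

section
/- If the penalty parameters satisfy η₂ ≤ ξ_B/(12Υ²) and η₁ ≥ 5Υ²/(η₂·ξ_G²), then the exact Newton direction satisfies Dᵀ(Δx, Δλ) ≤ −(η₂/2)·(‖g‖² + ‖c‖²) − (η₂·ξ_G/8)·(‖Δx‖² + ‖Δλ‖²). -/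
open scoped RealInnerProductSpace

/-- If `⟪w, G Gᵀ w⟫ ≥ ξ‖w‖²` with `ξ > 0`, then every `x` splits orthogonally as `u + v` with
`u ∈ ker G` and `ξ‖v‖² ≤ ‖G x‖²`. -/
lemma exists_ker_add_orthogonal_of_coercive {E F : Type*}
    [NormedAddCommGroup E] [InnerProductSpace ℝ E] [CompleteSpace E]
    [NormedAddCommGroup F] [InnerProductSpace ℝ F] [CompleteSpace F] [FiniteDimensional ℝ F]
    (G : E →L[ℝ] F) {ξ : ℝ} (hξ : 0 < ξ)
    (hG : ∀ w : F, ξ * ‖w‖ ^ 2 ≤ ⟪w, G (ContinuousLinearMap.adjoint G w)⟫) (x : E) :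
    ∃ u v : E, x = u + v ∧ G u = 0 ∧ ⟪u, v⟫ = 0 ∧ ξ * ‖v‖ ^ 2 ≤ ‖G x‖ ^ 2 := by
  have hinj : Function.Injective (G ∘L ContinuousLinearMap.adjoint G : F →L[ℝ] F).toLinearMap := by
    rw [← LinearMap.ker_eq_bot, LinearMap.ker_eq_bot']
    intro w hw
    have hw' : G (ContinuousLinearMap.adjoint G w) = 0 := hw
    have h := hG w
    rw [hw', inner_zero_right] at h
    have : ‖w‖ ^ 2 ≤ 0 := nonpos_of_mul_nonpos_right h hξ
    simpa using le_antisymm this (sq_nonneg _)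
  obtain ⟨w, hw⟩ := LinearMap.surjective_of_injective hinj (G x)
  have hw' : G (ContinuousLinearMap.adjoint G w) = G x := hw
  set v := ContinuousLinearMap.adjoint G w with hv
  have hker : G (x - v) = 0 := by rw [map_sub, hw', sub_self]
  refine ⟨x - v, v, by abel, hker, ?_, ?_⟩
  · rw [hv, ContinuousLinearMap.adjoint_inner_right, ← hv, hker, inner_zero_left]
  · have hvv : ‖v‖ ^ 2 = ⟪w, G x⟫ := by
      rw [← hw', ← ContinuousLinearMap.adjoint_inner_left, ← hv, real_inner_self_eq_norm_sq]
    have hwv : ξ * ‖w‖ ^ 2 ≤ ‖v‖ ^ 2 := by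
      rw [hvv, ← hw']
      exact hG w
    have hcs : ‖v‖ ^ 2 ≤ ‖w‖ * ‖G x‖ := hvv ▸ real_inner_le_norm _ _
    nlinarith [sq_nonneg (ξ * ‖w‖ - ‖G x‖)]

/-- The scalar estimate behind the descent property, with `X, L, P, C, U, V` standing for the norms
of `Δx`, `Δλ`, `g`, `c` and of the components of `Δx` along and orthogonal to `ker G`. -/
lemma descent_scalar_estimate {ξG ξB Υ η₁ η₂ X L P C U V : ℝ}
    (hξG0 : 0 < ξG) (hξG1 : ξG ≤ 1) (hξB0 : 0 < ξB) (hξB1 : ξB ≤ 1) (hΥ : 2 ≤ Υ)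
    (hη₂ : 0 < η₂) (hη₂le : η₂ ≤ ξB / (12 * Υ ^ 2)) (hη₁ge : 5 * Υ ^ 2 / (η₂ * ξG ^ 2) ≤ η₁)
    (hX : X ^ 2 = U ^ 2 + V ^ 2) (hV : ξG * V ^ 2 ≤ C ^ 2) (hL : ξG * L ^ 2 ≤ (P + Υ * X) ^ 2) :
    -(ξB * U ^ 2 - 2 * Υ * U * V - Υ * V ^ 2) + 2 * (C * L) + η₂ * (2 * Υ * P * X)
        - η₂ * P ^ 2 - η₁ * C ^ 2 ≤
      -(η₂ / 2) * (P ^ 2 + C ^ 2) - η₂ * ξG / 8 * (X ^ 2 + L ^ 2) := by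
  have hκ : 12 * (η₂ * Υ ^ 2) ≤ ξB := by
    rw [le_div_iff₀ (by positivity)] at hη₂le
    linarith
  have hη₂1 : 48 * η₂ ≤ ξB := by
    have : (4 : ℝ) ≤ Υ ^ 2 := by nlinarith
    linarith [mul_le_mul_of_nonneg_left this hη₂.le]
  have hΥη : η₂ * Υ ≤ 1 / 12 := by
    have : Υ ≤ Υ ^ 2 := by nlinarith
    linarith [mul_le_mul_of_nonneg_left this hη₂.le]
  obtain ⟨S, hS⟩ : ∃ S, S = C ^ 2 / (η₂ * ξG) := ⟨_, rfl⟩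
  obtain ⟨R, hR⟩ : ∃ R, R = V ^ 2 / η₂ := ⟨_, rfl⟩
  have hC : C ^ 2 = η₂ * ξG * S := by rw [hS]; field_simp
  have hVR : V ^ 2 = η₂ * R := by rw [hR]; field_simp
  have hS0 : 0 ≤ S := by rw [hS]; positivity
  have hR0 : 0 ≤ R := by rw [hR]; positivity
  have hRS : R ≤ S := by
    rw [hR, hS, div_le_div_iff₀ hη₂ (by positivity)]
    linarith [mul_le_mul_of_nonneg_left hV hη₂.le]
  have hη₁C : 20 * S ≤ η₁ * C ^ 2 := by
    have h : 20 / (η₂ * ξG) ≤ η₁ := by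
      refine le_trans ?_ hη₁ge
      rw [div_le_div_iff₀ (by positivity) (by positivity)]
      have : 4 * ξG ≤ Υ ^ 2 := by nlinarith
      nlinarith [mul_le_mul_of_nonneg_left this (by positivity : 0 ≤ 5 * (η₂ * ξG))]
    calc 20 * S = 20 / (η₂ * ξG) * C ^ 2 := by rw [hS]; ring
      _ ≤ η₁ * C ^ 2 := by gcongr
  have hCL : 2 * (C * L) ≤ η₂ * ξG / 8 * L ^ 2 + 8 * S := by
    have h : η₂ * ξG / 8 * L ^ 2 + 8 * S - 2 * (C * L)
        = (η₂ * ξG * L - 8 * C) ^ 2 / (8 * (η₂ * ξG)) := by rw [hS]; field_simp; ring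
    have : 0 ≤ (η₂ * ξG * L - 8 * C) ^ 2 / (8 * (η₂ * ξG)) := by positivity
    linarith
  have hLb : η₂ * ξG * L ^ 2 ≤ η₂ * (3 / 2 * P ^ 2) + 3 * (η₂ * Υ ^ 2) * X ^ 2 := by
    have h : ξG * L ^ 2 ≤ 3 / 2 * P ^ 2 + 3 * Υ ^ 2 * X ^ 2 := by
      nlinarith [sq_nonneg (P - 2 * (Υ * X))]
    linarith [mul_le_mul_of_nonneg_left h hη₂.le]
  have hPX : η₂ * (2 * Υ * P * X) ≤ η₂ * (1 / 8 * P ^ 2) + 8 * (η₂ * Υ ^ 2) * X ^ 2 := by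
    linarith [mul_nonneg hη₂.le (sq_nonneg (P - 8 * (Υ * X)))]
  have hUV : 2 * Υ * U * V ≤ ξB / 4 * U ^ 2 + R / 3 := by
    have h : 2 * Υ * U * V ≤ 3 * (η₂ * Υ ^ 2) * U ^ 2 + R / 3 := by
      have h' : 3 * (η₂ * Υ ^ 2) * U ^ 2 + R / 3 - 2 * Υ * U * V
          = (3 * η₂ * Υ * U - V) ^ 2 / (3 * η₂) := by rw [hR]; field_simp; ring
      have : 0 ≤ (3 * η₂ * Υ * U - V) ^ 2 / (3 * η₂) := by positivity
      linarith
    linarith [mul_le_mul_of_nonneg_right hκ (sq_nonneg U)]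
  have hΥV : Υ * V ^ 2 ≤ R / 12 := by 
    rw [hVR]
    linarith [mul_le_mul_of_nonneg_right hΥη hR0]
  have hκX : 12 * (η₂ * Υ ^ 2) * X ^ 2 ≤ ξB * X ^ 2 := by gcongr
  have hηX : 48 * (η₂ * ξG * X ^ 2) ≤ ξB * X ^ 2 := by
    have : 48 * (η₂ * ξG) ≤ ξB := by linarith [mul_le_mul_of_nonneg_left hξG1 hη₂.le]
    linarith [mul_le_mul_of_nonneg_right this (sq_nonneg X)]
  have hBX : ξB * X ^ 2 ≤ ξB * U ^ 2 + R := by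
    have : ξB * V ^ 2 ≤ R := by
      rw [hVR]
      have : ξB * η₂ ≤ 1 := mul_le_one₀ hξB1 hη₂.le (by linarith)
      linarith [mul_le_mul_of_nonneg_right this hR0]
    rw [hX]
    linarith
  have hBU : 0 ≤ ξB * U ^ 2 := by positivity
  have hηC : η₂ / 2 * C ^ 2 ≤ S := by
    rw [hC]
    have h1 : η₂ * ξG ≤ 1 := mul_le_one₀ (by linarith) hξG0.le hξG1
    have h2 : η₂ * (η₂ * ξG) ≤ 1 := mul_le_one₀ (by linarith) (by positivity) h1
    linarith [mul_le_mul_of_nonneg_right h2 hS0]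
  linarith

/-- If `η₂ ≤ ξ_B/(12Υ²)` and `η₁ ≥ 5Υ²/(η₂ξ_G²)`, the exact Newton
direction satisfies `Dᵀ(Δx, Δλ) ≤ −(η₂/2)(‖g‖²+‖c‖²) − (η₂ξ_G/8)(‖Δx‖²+‖Δλ‖²)`. -/
theorem stmt_1 (n m : ℕ)
    (H B : EuclideanSpace ℝ (Fin n) →L[ℝ] EuclideanSpace ℝ (Fin n))
    (G : EuclideanSpace ℝ (Fin n) →L[ℝ] EuclideanSpace ℝ (Fin m))
    (hH : IsSelfAdjoint H) (hB : IsSelfAdjoint B)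
    (ξG ξB Υ : ℝ) (hξG0 : 0 < ξG) (hξG1 : ξG ≤ 1) (hξB0 : 0 < ξB) (hξB1 : ξB ≤ 1)
    (hΥ : 2 ≤ Υ)
    (hGGT : ∀ w : EuclideanSpace ℝ (Fin m),
      ξG * ‖w‖ ^ 2 ≤ ⟪w, G (ContinuousLinearMap.adjoint G w)⟫)
    (hBcoer : ∀ u : EuclideanSpace ℝ (Fin n), G u = 0 → ξB * ‖u‖ ^ 2 ≤ ⟪u, B u⟫)
    (hnorms : max (max ‖H‖ ‖G‖) ‖B‖ ≤ Υ)
    (g : EuclideanSpace ℝ (Fin n)) (c : EuclideanSpace ℝ (Fin m))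
    (Δx : EuclideanSpace ℝ (Fin n)) (Δl : EuclideanSpace ℝ (Fin m))
    (hNewton1 : B Δx + ContinuousLinearMap.adjoint G Δl = -g)
    (hNewton2 : G Δx = -c)
    (η₁ η₂ : ℝ) (hη₁ : 0 < η₁) (hη₂ : 0 < η₂)
    (Dx : EuclideanSpace ℝ (Fin n)) (Dl : EuclideanSpace ℝ (Fin m))
    (hDx : Dx = g + η₂ • H g + η₁ • ContinuousLinearMap.adjoint G c)
    (hDl : Dl = c + η₂ • G g)
    (hη₂le : η₂ ≤ ξB / (12 * Υ ^ 2))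
    (hη₁ge : 5 * Υ ^ 2 / (η₂ * ξG ^ 2) ≤ η₁) :
    ⟪Dx, Δx⟫ + ⟪Dl, Δl⟫ ≤
      -(η₂ / 2) * (‖g‖ ^ 2 + ‖c‖ ^ 2) - η₂ * ξG / 8 * (‖Δx‖ ^ 2 + ‖Δl‖ ^ 2) := by
  have hHn : ‖H‖ ≤ Υ := ((le_max_left _ _).trans (le_max_left _ _)).trans hnorms
  have hBn : ‖B‖ ≤ Υ := (le_max_right _ _).trans hnorms
  have hAl : ContinuousLinearMap.adjoint G Δl = -(g + B Δx) := by
    rw [neg_add, ← hNewton1]; abel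
  obtain ⟨u, v, hx, hGu, huv, hv⟩ := exists_ker_add_orthogonal_of_coercive G hξG0 hGGT Δx
  rw [hNewton2, norm_neg] at hv
  have hX : ‖Δx‖ ^ 2 = ‖u‖ ^ 2 + ‖v‖ ^ 2 := by
    rw [hx, norm_add_sq_real, huv]; ring
  have hL : ξG * ‖Δl‖ ^ 2 ≤ (‖g‖ + Υ * ‖Δx‖) ^ 2 := by
    have h := hGGT Δl
    rw [← ContinuousLinearMap.adjoint_inner_left, real_inner_self_eq_norm_sq, hAl, norm_neg] at h
    refine h.trans ?_
    gcongr
    exact (norm_add_le _ _).trans (by gcongr; exact B.le_of_opNorm_le hBn Δx)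
  have hbilin : ∀ (A : EuclideanSpace ℝ (Fin n) →L[ℝ] EuclideanSpace ℝ (Fin n)), ‖A‖ ≤ Υ →
      ∀ y z, |⟪y, A z⟫| ≤ Υ * ‖y‖ * ‖z‖ := by
    intro A hA y z
    calc |⟪y, A z⟫| ≤ ‖y‖ * ‖A z‖ := abs_real_inner_le_norm _ _
      _ ≤ ‖y‖ * (Υ * ‖z‖) := by gcongr; exact A.le_of_opNorm_le hA z
      _ = Υ * ‖y‖ * ‖z‖ := by ring
  have hBsymm : ∀ y z, ⟪B y, z⟫ = ⟪y, B z⟫ :=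
    ContinuousLinearMap.isSelfAdjoint_iff_isSymmetric.mp hB
  have hHsymm : ∀ y z, ⟪H y, z⟫ = ⟪y, H z⟫ :=
    ContinuousLinearMap.isSelfAdjoint_iff_isSymmetric.mp hH
  have hxBx : ξB * ‖u‖ ^ 2 - 2 * Υ * ‖u‖ * ‖v‖ - Υ * ‖v‖ ^ 2 ≤ ⟪Δx, B Δx⟫ := by
    have h : ⟪Δx, B Δx⟫ = ⟪u, B u⟫ + 2 * ⟪u, B v⟫ + ⟪v, B v⟫ := by
      rw [hx, map_add, inner_add_left, inner_add_right, inner_add_right, ← hBsymm v u,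
        real_inner_comm u (B v)]
      ring
    have h1 := hBcoer u hGu
    have h2 := neg_le_of_abs_le (hbilin B hBn u v)
    have h3 := neg_le_of_abs_le (hbilin B hBn v v)
    rw [h]
    nlinarith
  have hexp : ⟪Dx, Δx⟫ + ⟪Dl, Δl⟫ = -⟪Δx, B Δx⟫ + 2 * ⟪c, Δl⟫
      + η₂ * (⟪g, H Δx⟫ - ⟪g, B Δx⟫) - η₂ * ‖g‖ ^ 2 - η₁ * ‖c‖ ^ 2 := by
    have h1 : ⟪ContinuousLinearMap.adjoint G c, Δx⟫ = -‖c‖ ^ 2 := by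
      rw [ContinuousLinearMap.adjoint_inner_left, hNewton2, inner_neg_right,
        real_inner_self_eq_norm_sq]
    have h2 : ⟪G g, Δl⟫ = -‖g‖ ^ 2 - ⟪g, B Δx⟫ := by
      rw [← ContinuousLinearMap.adjoint_inner_right, hAl, inner_neg_right, inner_add_right,
        real_inner_self_eq_norm_sq]
      ring
    have h3 : ⟪g, Δx⟫ = -⟪Δx, B Δx⟫ + ⟪c, Δl⟫ := by
      have hg : g = -(B Δx + ContinuousLinearMap.adjoint G Δl) := by rw [hNewton1, neg_neg]
      rw [hg, inner_neg_left, inner_add_left, ContinuousLinearMap.adjoint_inner_left, hNewton2,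
        inner_neg_right, hBsymm, real_inner_comm c Δl]
      ring
    rw [hDx, hDl]
    simp only [inner_add_left, real_inner_smul_left]
    rw [h1, h2, h3, hHsymm]
    ring
  have hcl := real_inner_le_norm c Δl
  have hgx : ⟪g, H Δx⟫ - ⟪g, B Δx⟫ ≤ 2 * Υ * ‖g‖ * ‖Δx‖ := by
    have h1 := le_of_abs_le (hbilin H hHn g Δx)
    have h2 := neg_le_of_abs_le (hbilin B hBn g Δx)
    linarith
  have hscal := descent_scalar_estimate hξG0 hξG1 hξB0 hξB1 hΥ hη₂ hη₂le hη₁ge hX hv hL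
  have hηgx := mul_le_mul_of_nonneg_left hgx hη₂.le
  rw [hexp]
  linarith
end

section
/- If the penalty parameters satisfy η₂ ≤ ξ_B/(12Υ²) and η₁ ≥ 5Υ²/(η₂·ξ_G²), then for every vector e ∈ ℝⁿ × ℝᵐ one has Dᵀe ≤ 2·η₁·Υ²·‖e‖·‖(Δx, Δλ)‖. (Bound on the contribution of the approximation error to the directional derivative of the exact augmented Lagrangian.) -/
open scoped RealInnerProductSpace

/-- Bound on the contribution of the approximation error to the
directional derivative of the exact augmented Lagrangian:
`Dᵀe ≤ 2η₁Υ²‖e‖‖(Δx,Δλ)‖` for every `e ∈ ℝⁿ × ℝᵐ`. -/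
theorem stmt_2 (n m : ℕ)
    (H B : EuclideanSpace ℝ (Fin n) →L[ℝ] EuclideanSpace ℝ (Fin n))
    (G : EuclideanSpace ℝ (Fin n) →L[ℝ] EuclideanSpace ℝ (Fin m))
    (hH : IsSelfAdjoint H) (hB : IsSelfAdjoint B)
    (ξG ξB Υ : ℝ) (hξG0 : 0 < ξG) (hξG1 : ξG ≤ 1) (hξB0 : 0 < ξB) (hξB1 : ξB ≤ 1)
    (hΥ : 2 ≤ Υ)
    (hGGT : ∀ w : EuclideanSpace ℝ (Fin m),
      ξG * ‖w‖ ^ 2 ≤ ⟪w, G (ContinuousLinearMap.adjoint G w)⟫)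
    (hBcoer : ∀ u : EuclideanSpace ℝ (Fin n), G u = 0 → ξB * ‖u‖ ^ 2 ≤ ⟪u, B u⟫)
    (hnorms : max (max ‖H‖ ‖G‖) ‖B‖ ≤ Υ)
    (g : EuclideanSpace ℝ (Fin n)) (c : EuclideanSpace ℝ (Fin m))
    (Δx : EuclideanSpace ℝ (Fin n)) (Δl : EuclideanSpace ℝ (Fin m))
    (hNewton1 : B Δx + ContinuousLinearMap.adjoint G Δl = -g)
    (hNewton2 : G Δx = -c)
    (η₁ η₂ : ℝ) (hη₁ : 0 < η₁) (hη₂ : 0 < η₂)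
    (Dx : EuclideanSpace ℝ (Fin n)) (Dl : EuclideanSpace ℝ (Fin m))
    (hDx : Dx = g + η₂ • H g + η₁ • ContinuousLinearMap.adjoint G c)
    (hDl : Dl = c + η₂ • G g)
    (hη₂le : η₂ ≤ ξB / (12 * Υ ^ 2))
    (hη₁ge : 5 * Υ ^ 2 / (η₂ * ξG ^ 2) ≤ η₁) :
    ∀ (ex : EuclideanSpace ℝ (Fin n)) (el : EuclideanSpace ℝ (Fin m)),
      ⟪Dx, ex⟫ + ⟪Dl, el⟫ ≤
        2 * η₁ * Υ ^ 2 * Real.sqrt (‖ex‖ ^ 2 + ‖el‖ ^ 2)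
          * Real.sqrt (‖Δx‖ ^ 2 + ‖Δl‖ ^ 2) := by
  intro ex el
  set N := Real.sqrt (‖Δx‖ ^ 2 + ‖Δl‖ ^ 2)
  set E := Real.sqrt (‖ex‖ ^ 2 + ‖el‖ ^ 2)
  have hN : 0 ≤ N := Real.sqrt_nonneg _
  have hE : 0 ≤ E := Real.sqrt_nonneg _
  have hxN : ‖Δx‖ ≤ N := Real.le_sqrt_of_sq_le (by nlinarith [sq_nonneg ‖Δl‖])
  have hlN : ‖Δl‖ ≤ N := Real.le_sqrt_of_sq_le (by nlinarith [sq_nonneg ‖Δx‖])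
  have hxE : ‖ex‖ ≤ E := Real.le_sqrt_of_sq_le (by nlinarith [sq_nonneg ‖el‖])
  have hlE : ‖el‖ ≤ E := Real.le_sqrt_of_sq_le (by nlinarith [sq_nonneg ‖ex‖])
  have hΥ0 : 0 ≤ Υ := by linarith
  have hHn : ‖H‖ ≤ Υ := (le_max_left _ _).trans ((le_max_left _ _).trans hnorms)
  have hGn : ‖G‖ ≤ Υ := (le_max_right _ _).trans ((le_max_left _ _).trans hnorms)
  have hBn : ‖B‖ ≤ Υ := (le_max_right _ _).trans hnorms
  have hGTn : ‖ContinuousLinearMap.adjoint G‖ ≤ Υ := by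
    rwa [LinearIsometryEquiv.norm_map]
  have hg : ‖g‖ ≤ 2 * Υ * N := by
    rw [← norm_neg g, ← hNewton1]
    linarith [norm_add_le (B Δx) (ContinuousLinearMap.adjoint G Δl),
      B.le_of_opNorm_le_of_le hBn hxN,
      (ContinuousLinearMap.adjoint G).le_of_opNorm_le_of_le hGTn hlN]
  have hc : ‖c‖ ≤ Υ * N := by
    rw [← norm_neg c, ← hNewton2]
    exact G.le_of_opNorm_le_of_le hGn hxN
  have hη₂Υ : η₂ * Υ ≤ 1 / 24 := by
    rw [le_div_iff₀ (by positivity)] at hη₂le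
    nlinarith [mul_nonneg (mul_nonneg hη₂.le hΥ0) (sub_nonneg.2 hΥ)]
  have hη₁4 : 4 ≤ η₁ := by
    have hη₂1 : η₂ ≤ 1 := by nlinarith
    have hden : η₂ * ξG ^ 2 ≤ 1 := mul_le_one₀ hη₂1 (by positivity) (pow_le_one₀ hξG0.le hξG1)
    rw [div_le_iff₀ (by positivity)] at hη₁ge
    nlinarith
  have hDxn : ‖Dx‖ ≤ 2 * Υ * N + η₂ * (Υ * (2 * Υ * N)) + η₁ * (Υ * (Υ * N)) := by
    rw [hDx]
    refine norm_add₃_le.trans ?_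
    rw [norm_smul_of_nonneg hη₂.le, norm_smul_of_nonneg hη₁.le]
    gcongr
    · exact H.le_of_opNorm_le_of_le hHn hg
    · exact (ContinuousLinearMap.adjoint G).le_of_opNorm_le_of_le hGTn hc
  have hDln : ‖Dl‖ ≤ Υ * N + η₂ * (Υ * (2 * Υ * N)) := by
    rw [hDl]
    refine (norm_add_le _ _).trans ?_
    rw [norm_smul_of_nonneg hη₂.le]
    gcongr
    exact G.le_of_opNorm_le_of_le hGn hg
  have hsum : ‖Dx‖ + ‖Dl‖ ≤ 2 * η₁ * Υ ^ 2 * N := by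
    have hΥN : 0 ≤ Υ * N := mul_nonneg hΥ0 hN
    have hη₁Υ : 4 ≤ η₁ * Υ := by nlinarith
    linarith [mul_le_mul_of_nonneg_right hη₂Υ hΥN, mul_le_mul_of_nonneg_right hη₁Υ hΥN]
  calc ⟪Dx, ex⟫ + ⟪Dl, el⟫ ≤ ‖Dx‖ * ‖ex‖ + ‖Dl‖ * ‖el‖ :=
        add_le_add (real_inner_le_norm _ _) (real_inner_le_norm _ _)
    _ ≤ ‖Dx‖ * E + ‖Dl‖ * E := by gcongr
    _ = (‖Dx‖ + ‖Dl‖) * E := by ring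
    _ ≤ 2 * η₁ * Υ ^ 2 * N * E := by gcongr
    _ = 2 * η₁ * Υ ^ 2 * E * N := by ring
end

section
/- Let φ : ℝᵈ → ℝ be differentiable with L-Lipschitz gradient (L > 0). Let z, p ∈ ℝᵈ, and let N ≥ 0, η > 0, Ψ > 0, and β ∈ (0,1). Suppose ⟨∇φ(z), p⟩ ≤ −(η/2)·N² and ‖p‖ ≤ 2·Ψ·N. Then for every stepsize α with 0 < α ≤ (1−β)·η/(4·L·Ψ²), the Armijo condition holds: φ(z + α·p) ≤ φ(z) + α·β·⟨∇φ(z), p⟩. (Deterministic core of Lemma 4.5 / 'Lemma 13': the backtracking stepsizes admit a uniform positive lower bound.) -/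
open scoped RealInnerProductSpace

/-- The descent lemma: a differentiable function with `L`-Lipschitz gradient is bounded above by its
quadratic model. -/
theorem descent_of_lipschitz_gradient {E : Type*} [NormedAddCommGroup E] [InnerProductSpace ℝ E]
    [CompleteSpace E] {φ : E → ℝ} {L : ℝ} (hdiff : Differentiable ℝ φ)
    (hlip : ∀ u v : E, ‖gradient φ u - gradient φ v‖ ≤ L * ‖u - v‖) (z p : E)
    {α : ℝ} (hα : 0 ≤ α) :
    φ (z + α • p) ≤ φ z + α * ⟪gradient φ z, p⟫ + L * α ^ 2 / 2 * ‖p‖ ^ 2 := by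
  set g := ⟪gradient φ z, p⟫ with hg
  have hderiv (t : ℝ) : HasDerivAt
      (fun s : ℝ => φ (z + s • p) - s * g - L * s ^ 2 / 2 * ‖p‖ ^ 2)
      (⟪gradient φ (z + t • p), p⟫ - g - L * t * ‖p‖ ^ 2) t := by
    have hline : HasDerivAt (fun s : ℝ => z + s • p) p t := by
      simpa using ((hasDerivAt_id t).smul_const p).const_add z
    have hφ : HasDerivAt (fun s : ℝ => φ (z + s • p)) ⟪gradient φ (z + t • p), p⟫ t := by
      exact (hdiff (z + t • p)).hasGradientAt.hasFDerivAt.comp_hasDerivAt t hline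
    have hlin : HasDerivAt (fun s : ℝ => s * g) g t := by
      simpa using (hasDerivAt_id t).mul_const g
    have hquad : HasDerivAt (fun s : ℝ => L * s ^ 2 / 2 * ‖p‖ ^ 2) (L * t * ‖p‖ ^ 2) t := by
      convert! (((hasDerivAt_pow 2 t).const_mul L).div_const 2).mul_const (‖p‖ ^ 2) using 1
      push_cast
      ring
    exact (hφ.sub hlin).sub hquad
  have hanti : AntitoneOn
      (fun s : ℝ => φ (z + s • p) - s * g - L * s ^ 2 / 2 * ‖p‖ ^ 2) (Set.Ici 0) := by
    refine antitoneOn_of_deriv_nonpos (convex_Ici 0)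
      (fun t _ => (hderiv t).continuousAt.continuousWithinAt)
      (fun t _ => (hderiv t).differentiableAt.differentiableWithinAt) fun t ht => ?_
    have ht : 0 < t := by simpa using ht
    rw [(hderiv t).deriv, hg, ← inner_sub_left]
    have hgrad : ‖gradient φ (z + t • p) - gradient φ z‖ ≤ L * (t * ‖p‖) := by
      simpa [norm_smul, abs_of_pos ht] using hlip (z + t • p) z
    have hinner := (real_inner_le_norm (gradient φ (z + t • p) - gradient φ z) p).trans
      (mul_le_mul_of_nonneg_right hgrad (norm_nonneg p))
    linarith
  have h := hanti Set.self_mem_Ici (Set.mem_Ici.2 hα) hα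
  simp only [zero_smul, add_zero] at h
  linarith

/-- deterministic core of Lemma 13. For a function with
`L`-Lipschitz gradient, if `⟨∇φ(z), p⟩ ≤ −(η/2)N²` and `‖p‖ ≤ 2ΨN`, then every
stepsize `α ∈ (0, (1−β)η/(4LΨ²)]` satisfies the Armijo condition. -/
theorem stmt_3 (d : ℕ) (φ : EuclideanSpace ℝ (Fin d) → ℝ)
    (L : ℝ) (hL : 0 < L)
    (hdiff : Differentiable ℝ φ)
    (hlip : ∀ u v : EuclideanSpace ℝ (Fin d),
      ‖gradient φ u - gradient φ v‖ ≤ L * ‖u - v‖)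
    (z p : EuclideanSpace ℝ (Fin d))
    (N η Ψ β : ℝ) (hN : 0 ≤ N) (hη : 0 < η) (hΨ : 0 < Ψ)
    (hβ0 : 0 < β) (hβ1 : β < 1)
    (hdesc : ⟪gradient φ z, p⟫ ≤ -(η / 2) * N ^ 2)
    (hp : ‖p‖ ≤ 2 * Ψ * N) :
    ∀ α : ℝ, 0 < α → α ≤ (1 - β) * η / (4 * L * Ψ ^ 2) →
      φ (z + α • p) ≤ φ z + α * β * ⟪gradient φ z, p⟫ := by
  intro α hα hαle
  have hmodel := descent_of_lipschitz_gradient hdiff hlip z p hα.le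
  have hstep : α * (4 * L * Ψ ^ 2) ≤ (1 - β) * η := (le_div_iff₀ (by positivity)).1 hαle
  have hp_sq : ‖p‖ ^ 2 ≤ (2 * Ψ * N) ^ 2 := pow_le_pow_left₀ (norm_nonneg p) hp 2
  have hquad : L * α ^ 2 / 2 * ‖p‖ ^ 2 ≤ L * α ^ 2 / 2 * (2 * Ψ * N) ^ 2 := by gcongr
  have hlin : α * (1 - β) * ⟪gradient φ z, p⟫ ≤ α * (1 - β) * (-(η / 2) * N ^ 2) :=
    mul_le_mul_of_nonneg_left hdesc (mul_nonneg hα.le (by linarith))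
  have hbalance : α * N ^ 2 / 2 * (α * (4 * L * Ψ ^ 2)) ≤ α * N ^ 2 / 2 * ((1 - β) * η) := by
    gcongr
  linarith
end

section
/- Let q₁, …, q_N be unit vectors in ℝᵈ whose linear span is all of ℝᵈ. Then the operator norm of the ordered product (I − q_N q_Nᵀ)·(I − q_{N−1} q_{N−1}ᵀ)⋯(I − q₁ q₁ᵀ) is strictly less than 1. -/
section

variable {E : Type*} [NormedAddCommGroup E] [InnerProductSpace ℝ E]

/-- Pythagoras for the orthogonal projection `I - q qᵀ` along a unit vector `q`. -/
lemma norm_sq_one_sub_smulRight_apply {q : E} (hq : ‖q‖ = 1) (x : E) :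
    ‖((1 : E →L[ℝ] E) - (innerSL ℝ q).smulRight q) x‖ ^ 2 = ‖x‖ ^ 2 - inner ℝ q x ^ 2 := by
  have h : ((1 : E →L[ℝ] E) - (innerSL ℝ q).smulRight q) x = x - inner ℝ q x • q := by simp
  rw [h, norm_sub_sq_real, norm_smul, hq, inner_smul_right, real_inner_comm, mul_one,
    Real.norm_eq_abs, sq_abs]
  ring

/-- A product of projections along unit vectors is a contraction, and it preserves the norm of `x`
only if `x` is orthogonal to each of these vectors. -/
lemma norm_prod_one_sub_smulRight_apply (l : List E) (hl : ∀ q ∈ l, ‖q‖ = 1) (x : E) :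
    ‖((l.map fun q => (1 : E →L[ℝ] E) - (innerSL ℝ q).smulRight q).reverse).prod x‖ ≤ ‖x‖ ∧
    (‖((l.map fun q => (1 : E →L[ℝ] E) - (innerSL ℝ q).smulRight q).reverse).prod x‖ = ‖x‖ →
      ∀ q ∈ l, inner ℝ q x = 0) := by
  induction l generalizing x with
  | nil => simp
  | cons q t ih =>
    have ih' := ih fun p hp => hl p (List.mem_cons_of_mem q hp)
    have hsq := norm_sq_one_sub_smulRight_apply (hl q List.mem_cons_self) x
    have hle : ‖((1 : E →L[ℝ] E) - (innerSL ℝ q).smulRight q) x‖ ≤ ‖x‖ :=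
      (sq_le_sq₀ (norm_nonneg _) (norm_nonneg _)).1 (by nlinarith [sq_nonneg (inner ℝ q x)])
    rw [List.map_cons, List.reverse_cons, List.prod_append, List.prod_singleton,
      mul_apply_eq_comp]
    refine ⟨(ih' _).1.trans hle, fun heq => ?_⟩
    have hnorm := le_antisymm hle (heq ▸ (ih' _).1)
    have hq : inner ℝ q x = 0 := by
      rw [hnorm] at hsq
      exact pow_eq_zero_iff two_ne_zero |>.1 (by linarith)
    have hfix : ((1 : E →L[ℝ] E) - (innerSL ℝ q).smulRight q) x = x := by simp [hq]
    rw [hfix] at heq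
    exact List.forall_mem_cons.2 ⟨hq, (ih' x).2 heq⟩

/-- In finite dimension, an operator that strictly decreases the norm of every nonzero vector
has operator norm less than one. -/
lemma ContinuousLinearMap.norm_lt_one_of_forall_norm_apply_lt [FiniteDimensional ℝ E]
    (T : E →L[ℝ] E) (hT : ∀ x, x ≠ 0 → ‖T x‖ < ‖x‖) : ‖T‖ < 1 := by
  have : ProperSpace E := FiniteDimensional.proper ℝ E
  obtain ⟨x, hx, hmax⟩ := (isCompact_closedBall (0 : E) 1).exists_isMaxOn
    ⟨0, by simp⟩ (f := fun x => ‖T x‖) (by fun_prop)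
  have hle : ‖T‖ ≤ ‖T x‖ := T.opNorm_le_of_unit_norm (norm_nonneg _) fun y hy =>
    hmax (by simp [hy])
  refine hle.trans_lt ?_
  rcases eq_or_ne x 0 with rfl | h0
  · simp
  · exact (hT x h0).trans_le (by simpa using hx)

end

/-- If unit vectors `q₁, …, q_N` span `ℝᵈ`, then the operator norm
of the ordered product `(I − q_N q_Nᵀ)⋯(I − q₁ q₁ᵀ)` is strictly less than `1`. -/
theorem stmt_13 (d N : ℕ) (q : Fin N → EuclideanSpace ℝ (Fin d))
    (hunit : ∀ i, ‖q i‖ = 1)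
    (hspan : Submodule.span ℝ (Set.range q) = ⊤) :
    ‖((List.ofFn (fun i : Fin N =>
        (1 : EuclideanSpace ℝ (Fin d) →L[ℝ] EuclideanSpace ℝ (Fin d)) -
          (innerSL ℝ (q i)).smulRight (q i))).reverse).prod‖ < 1 := by
  refine ContinuousLinearMap.norm_lt_one_of_forall_norm_apply_lt _ fun x hx => ?_
  have key := norm_prod_one_sub_smulRight_apply (List.ofFn q)
    (by simpa [List.mem_ofFn] using hunit) x
  rw [List.map_ofFn] at key
  refine lt_of_le_of_ne key.1 fun heq => hx ?_
  have horth : Submodule.span ℝ (Set.range q) ≤ (ℝ ∙ x)ᗮ := by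
    rw [Submodule.span_le]
    rintro _ ⟨i, rfl⟩
    exact Submodule.mem_orthogonal_singleton_iff_inner_left.2
      (key.2 heq (q i) (List.mem_ofFn.2 ⟨i, rfl⟩))
  rw [hspan] at horth
  exact inner_self_eq_zero.1
    (Submodule.mem_orthogonal_singleton_iff_inner_left.1 (horth (Submodule.mem_top (x := x))))
end
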